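/- Let C be an upwards-deterministic hybrid circuit with panel B = (V, E). For every valuation ν of C, the directed graph consisting of the edges of B mapped to 1 by the wiring β_ν is a forest: there is no gate g ∈ V and distinct gates g' ≠ g'' in V with β_ν((g, g')) = β_ν((g, g'')) = 1. -/

import Mathlib

namespace MSOEnum

inductive GateType : Type
  | svar | bvar | union | prod | box | band | bor | bnot
  deriving DecidableEq

def GateType.isBoolean : GateType → Prop
  | .bvar => True
  | .band => True
  | .bor => True
  | .bnot => True
  | _ => False

/-- A hybrid circuit: a finite DAG of gates, where `wire g g'` means that `g`
is an input of `g'`, with an output gate and gate types satisfying the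
structural requirements of hybrid circuits. -/
structure HybridCircuit (α : Type) where
  gates : Finset α
  wire : α → α → Prop
  wire_mem : ∀ a b, wire a b → a ∈ gates ∧ b ∈ gates
  acyclic : WellFounded wire
  τ : α → GateType
  out : α
  out_mem : out ∈ gates
  out_setValued : ¬ (τ out).isBoolean
  var_no_input : ∀ g, (τ g = GateType.svar ∨ τ g = GateType.bvar) → ∀ g', ¬ wire g' g
  boolGate_inputs : ∀ g, (τ g = GateType.band ∨ τ g = GateType.bor ∨ τ g = GateType.bnot) →
    ∀ g', wire g' g → (τ g').isBoolean
  bnot_input : ∀ g ∈ gates, τ g = GateType.bnot → ∃! g', wire g' g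
  setGate_inputs : ∀ g, (τ g = GateType.union ∨ τ g = GateType.prod) →
    ∀ g', wire g' g → ¬ (τ g').isBoolean
  prod_inputs : ∀ g ∈ gates, τ g = GateType.prod →
    (∀ g', ¬ wire g' g) ∨
    ∃ g₁ g₂, g₁ ≠ g₂ ∧ wire g₁ g ∧ wire g₂ g ∧ ∀ g', wire g' g → g' = g₁ ∨ g' = g₂
  box_inputs : ∀ g ∈ gates, τ g = GateType.box →
    ∃ gs gb, ¬ (τ gs).isBoolean ∧ (τ gb).isBoolean ∧ wire gs g ∧ wire gb g ∧
      ∀ g', wire g' g → g' = gs ∨ g' = gb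

variable {α : Type}

open Classical in
/-- The Boolean value `⟨g⟩_ν` captured by each (Boolean) gate, computed bottom-up. -/
noncomputable def bval (C : HybridCircuit α) (ν : α → Bool) : α → Bool :=
  C.acyclic.fix fun g rec =>
    match C.τ g with
    | .bvar => ν g
    | .band => decide (∀ g' (h : C.wire g' g), rec g' h = true)
    | .bor => decide (∃ g', ∃ h : C.wire g' g, rec g' h = true)
    | .bnot => decide (∀ g' (h : C.wire g' g), rec g' h = false)
    | _ => false

open Classical in
/-- The set `⟦g⟧_ν` of assignments captured by each (set-valued) gate, computed bottom-up. -/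
noncomputable def sval (C : HybridCircuit α) (ν : α → Bool) : α → Set (Set α) :=
  C.acyclic.fix fun g rec =>
    match C.τ g with
    | .svar => {{g}}
    | .union => {a | ∃ g', ∃ h : C.wire g' g, a ∈ rec g' h}
    | .prod =>
        if ∀ g', ¬ C.wire g' g then {∅}
        else {a | ∃ g₁ g₂, ∃ (h₁ : C.wire g₁ g) (h₂ : C.wire g₂ g), g₁ ≠ g₂ ∧
          ∃ a₁ ∈ rec g₁ h₁, ∃ a₂ ∈ rec g₂ h₂, a = a₁ ∪ a₂}
    | .box => {a | (∃ g', ∃ h : C.wire g' g, ¬ (C.τ g').isBoolean ∧ a ∈ rec g' h) ∧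
        ∀ g'', C.wire g'' g → (C.τ g'').isBoolean → bval C ν g'' = true}
    | _ => (∅ : Set (Set α))

open Classical in
/-- The partial evaluation `ω_ν`. -/
noncomputable def omegaEval (C : HybridCircuit α) (ν : α → Bool) (g : α) : Bool :=
  if (C.τ g).isBoolean then bval C ν g else decide (sval C ν g).Nonempty

def boxStep (C : HybridCircuit α) (a b : α) : Prop := C.wire a b ∧ C.τ b = GateType.box

/-- A ⊠-path from `g'` to `g` that is live under `ν`. -/
def liveBoxPath (C : HybridCircuit α) (ν : α → Bool) (g' g : α) : Prop :=
  ∃ g'', Relation.ReflTransGen (boxStep C) g' g'' ∧ C.wire g'' g ∧ omegaEval C ν g'' = true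

/-- A ∪-path from `g'` to `g` that is live under `ν`. -/
def liveUnionPath (C : HybridCircuit α) (ν : α → Bool) (g' g : α) : Prop :=
  ∃ g'', Relation.ReflTransGen
      (fun a b => liveBoxPath C ν a b ∧ C.τ b = GateType.union) g' g'' ∧
    liveBoxPath C ν g'' g

def isExit (C : HybridCircuit α) (g : α) : Prop :=
  C.τ g = GateType.prod ∨ C.τ g = GateType.svar

/-- The set `D^ν_g` of exits having a live ∪-path to `g` under `ν`. -/
def exitsOf (C : HybridCircuit α) (ν : α → Bool) (g : α) : Set α :=
  {g' | isExit C g' ∧ liveUnionPath C ν g' g}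

def deterministic (C : HybridCircuit α) : Prop :=
  ∀ (ν : α → Bool), ∀ g ∈ C.gates, C.τ g = GateType.union →
    ∀ g₁ g₂, C.wire g₁ g → C.wire g₂ g → g₁ ≠ g₂ →
      Disjoint (sval C ν g₁) (sval C ν g₂)

def decomposable (C : HybridCircuit α) : Prop :=
  ∀ g ∈ C.gates, C.τ g = GateType.prod →
    ∀ g₁ g₂, C.wire g₁ g → C.wire g₂ g → g₁ ≠ g₂ →
      ∀ v, C.τ v = GateType.svar →
        ¬ (Relation.ReflTransGen C.wire v g₁ ∧ Relation.ReflTransGen C.wire v g₂)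

def isDDNNF (C : HybridCircuit α) : Prop := decomposable C ∧ deterministic C

/-- The wire `(g, g')` (with `g` set-valued) is pure under `ν`. -/
def pureWire (C : HybridCircuit α) (ν : α → Bool) (g g' : α) : Prop :=
  C.wire g g' ∧ ¬ (C.τ g).isBoolean ∧
    (C.τ g' = GateType.union ∨
     (C.τ g' = GateType.box ∧
       ∀ g'', C.wire g'' g' → (C.τ g'').isBoolean → bval C ν g'' = true) ∨
     (C.τ g' = GateType.prod ∧ ∃ g'', C.wire g'' g' ∧ g'' ≠ g ∧ (∅ : Set α) ∈ sval C ν g''))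

def upwardsDeterministic (C : HybridCircuit α) : Prop :=
  ∀ (ν : α → Bool) (g g₁ g₂ : α), pureWire C ν g g₁ → pureWire C ν g g₂ → g₁ = g₂

def homogenized (C : HybridCircuit α) : Prop :=
  ¬ ∃ (ν : α → Bool) (g : α), g ∈ C.gates ∧ ¬ (C.τ g).isBoolean ∧ (∅ : Set α) ∈ sval C ν g

noncomputable def fanIn (C : HybridCircuit α) (g : α) : ℕ := {g' | C.wire g' g}.ncard

noncomputable def maxFanIn (C : HybridCircuit α) : ℕ := C.gates.sup (fanIn C)

/-- `Δ(g)`: the gates to which `g` has a directed path. -/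
def deltaSet (C : HybridCircuit α) (g : α) : Set α := {g' | Relation.ReflTransGen C.wire g g'}

/-- The dependency size `Δ(C)`. -/
noncomputable def depSize (C : HybridCircuit α) : ℕ :=
  C.gates.sup fun g => (deltaSet C g).ncard

end MSOEnum

namespace MSOEnum

/-- `deltaRel C a h`: `a` is the (non-⊠, set-valued) gate `δ(h)`, i.e. `a` is not Boolean,
not a ⊠-gate, and has a directed path to `h` in which all gates other than `a` are ⊠-gates
(the empty path when `h = a`). -/
def deltaRel {α : Type} (C : HybridCircuit α) (a h : α) : Prop :=
  ¬ (C.τ a).isBoolean ∧ C.τ a ≠ GateType.box ∧ Relation.ReflTransGen (boxStep C) a h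

/-- `panelEdge C a b`: `(a, b)` is an edge of the panel `B` of `C`, i.e. `b` is a ∪-gate
and `a = δ(g')` for some wire `(g', b)` of `C`. -/
def panelEdge {α : Type} (C : HybridCircuit α) (a b : α) : Prop :=
  C.τ b = GateType.union ∧ ∃ h, C.wire h b ∧ deltaRel C a h

/-- A gate reached from a set-valued gate by a path of ⊠-gates is set-valued. -/
theorem not_isBoolean_of_boxPath {α : Type} {C : HybridCircuit α} {a g : α}
    (ha : ¬ (C.τ a).isBoolean) (h : Relation.ReflTransGen (boxStep C) a g) :
    ¬ (C.τ g).isBoolean := by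
  rcases Relation.ReflTransGen.cases_tail h with rfl | ⟨c, -, -, hg⟩
  · exact ha
  · simp [hg, GateType.isBoolean]

theorem mem_sval_box {α : Type} {C : HybridCircuit α} {ν : α → Bool} {g : α} {s : Set α}
    (hg : C.τ g = GateType.box) :
    s ∈ sval C ν g ↔ (∃ g', ¬ (C.τ g').isBoolean ∧ C.wire g' g ∧ s ∈ sval C ν g') ∧
      ∀ g'', C.wire g'' g → (C.τ g'').isBoolean → bval C ν g'' = true := by
  unfold sval
  rw [C.acyclic.fix_eq]
  simp [hg]

/-- A ⊠-gate has only one set-valued input. -/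
theorem box_setInput_unique {α : Type} {C : HybridCircuit α} {g x y : α}
    (hg : C.τ g = GateType.box) (hx : C.wire x g) (hy : C.wire y g)
    (hxb : ¬ (C.τ x).isBoolean) (hyb : ¬ (C.τ y).isBoolean) : x = y := by
  obtain ⟨gs, gb, -, hgb, -, -, h⟩ := C.box_inputs g (C.wire_mem _ _ hx).2 hg
  rcases h x hx with rfl | rfl
  · rcases h y hy with rfl | rfl
    · rfl
    · exact absurd hgb hyb
  · exact absurd hgb hxb

/-- The wires of a path of ⊠-gates ending in a gate that captures a nonempty set are pure. -/
theorem purePath_of_boxPath {α : Type} {C : HybridCircuit α} {ν : α → Bool} {a g : α}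
    (ha : ¬ (C.τ a).isBoolean) (h : Relation.ReflTransGen (boxStep C) a g)
    (hne : (sval C ν g).Nonempty) :
    Relation.ReflTransGen (fun x y => pureWire C ν x y ∧ C.τ y = GateType.box) a g := by
  induction h with
  | refl => exact .refl
  | @tail b c hab hbc ih =>
    obtain ⟨hw, hc⟩ := hbc
    have hb := not_isBoolean_of_boxPath ha hab
    obtain ⟨s, hs⟩ := hne
    obtain ⟨⟨b', hb', hw', hs'⟩, htrue⟩ := (mem_sval_box hc).1 hs
    obtain rfl := box_setInput_unique hc hw hw' hb hb'
    exact (ih ⟨s, hs'⟩).tail ⟨⟨hw, hb, .inr (.inl ⟨hc, htrue⟩)⟩, hc⟩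

/-- A live ⊠-path from a set-valued gate to a ∪-gate consists of pure wires. -/
theorem exists_purePath_of_liveBoxPath {α : Type} {C : HybridCircuit α} {ν : α → Bool} {a b : α}
    (ha : ¬ (C.τ a).isBoolean) (hb : C.τ b = GateType.union) (h : liveBoxPath C ν a b) :
    ∃ g, Relation.ReflTransGen (fun x y => pureWire C ν x y ∧ C.τ y = GateType.box) a g ∧
      pureWire C ν g b := by
  obtain ⟨g, hag, hw, hω⟩ := h
  have hg := not_isBoolean_of_boxPath ha hag
  refine ⟨g, purePath_of_boxPath ha hag ?_, hw, hg, .inl hb⟩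
  simpa [omegaEval, hg] using hω

/-- Pure wires leaving a path of pure wires into ⊠-gates, at its start and at its end,
lead to the same ∪-gate. -/
theorem upwardsDeterministic.union_unique {α : Type} {C : HybridCircuit α}
    (hud : upwardsDeterministic C) {ν : α → Bool} {g g' b b' : α}
    (hb : C.τ b = GateType.union) (hgb : pureWire C ν g b) (hgb' : pureWire C ν g' b')
    (h : Relation.ReflTransGen (fun x y => pureWire C ν x y ∧ C.τ y = GateType.box) g g') :
    b = b' := by
  rcases Relation.ReflTransGen.cases_head h with rfl | ⟨c, ⟨hgc, hc⟩, -⟩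
  · exact hud ν _ _ _ hgb hgb'
  · obtain rfl := hud ν _ _ _ hgb hgc
    simp [hb] at hc

/-- if `C` is upwards-deterministic then, for every valuation `ν`, the graph of
panel edges whose wiring value `β_ν` is 1 (i.e., panel edges `(a, b)` such that there is a
live ⊠-path from `a` to `b` under `ν`) is a forest: no gate has two distinct outgoing
edges mapped to 1 by `β_ν`. -/
theorem switchboard_forest {α : Type} (C : HybridCircuit α)
    (hud : upwardsDeterministic C) (ν : α → Bool) :
    ¬ ∃ a b b', b ≠ b' ∧ panelEdge C a b ∧ panelEdge C a b' ∧
      liveBoxPath C ν a b ∧ liveBoxPath C ν a b' := by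
  rintro ⟨a, b, b', hne, ⟨hb, _, -, ha, -⟩, ⟨hb', -⟩, hab, hab'⟩
  obtain ⟨g, hag, hgb⟩ := exists_purePath_of_liveBoxPath ha hb hab
  obtain ⟨g', hag', hgb'⟩ := exists_purePath_of_liveBoxPath ha hb' hab'
  have hru : Relator.RightUnique
      (fun x y => pureWire C ν x y ∧ C.τ y = GateType.box) :=
    fun x y z hy hz => hud ν x y z hy.1 hz.1
  rcases Relation.ReflTransGen.total_of_right_unique hru hag hag' with h | h
  · exact hne (hud.union_unique hb hgb hgb' h)
  · exact hne (hud.union_unique hb' hgb' hgb h).symm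

end MSOEnum
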